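/- arXiv:1612.03375 — 2 statements merged into one kernel-verified Lean document; each statement's English description precedes it below -/
import Mathlib

section
/- For all integers L ≥ 1 and M ≥ L+1, the minimum over w ∈ ℝ^L of ‖Bw − 𝟏‖₂ equals (binom(M+L+1, L+1)/binom(M, L+1) − 1)^{−1/2}. -/
open Finset

open Polynomial in
/-- Subtracting a translate of a polynomial from it lowers the degree. -/
lemma natDegree_taylor_sub_le (r : ℝ) (p : ℝ[X]) :
    (taylor r p - p).natDegree ≤ p.natDegree - 1 := by
  rcases Nat.eq_zero_or_pos p.natDegree with h | h
  · rw [eq_C_of_natDegree_eq_zero h]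
    simp
  · have hp : p ≠ 0 := by
      rintro rfl
      simp at h
    have hlt := degree_sub_lt_right (degree_taylor p r) hp (leadingCoeff_taylor r p)
    by_cases h0 : taylor r p - p = 0
    · simp [h0]
    · have := natDegree_lt_natDegree h0 hlt
      omega

open Polynomial in
lemma natDegree_iterate_taylor_sub_le (r : ℝ) (p : ℝ[X]) (n : ℕ) :
    ((fun q : ℝ[X] => taylor r q - q)^[n] p).natDegree ≤ p.natDegree - n := by
  induction n with
  | zero => simp
  | succ n ih =>
    rw [Function.iterate_succ_apply']
    have := natDegree_taylor_sub_le r ((fun q : ℝ[X] => taylor r q - q)^[n] p)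
    omega

open Polynomial in
lemma eval_iterate_taylor_sub (r : ℝ) (p : ℝ[X]) (n : ℕ) (x : ℝ) :
    ((fun q : ℝ[X] => taylor r q - q)^[n] p).eval x = (fwdDiff r)^[n] (fun y => p.eval y) x := by
  induction n generalizing x with
  | zero => simp
  | succ n ih =>
    rw [Function.iterate_succ_apply', Function.iterate_succ_apply']
    simp [fwdDiff, taylor_eval, ih]

lemma fwdDiff_iterate_eq_neg_one_pow_mul (h : ℝ) (f : ℝ → ℝ) (n : ℕ) (y : ℝ) :
    (fwdDiff h)^[n] f y
      = (-1) ^ n * ∑ k ∈ range (n + 1), (-1) ^ k * (n.choose k : ℝ) * f (y + k * h) := by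
  rw [fwdDiff_iter_eq_sum_shift, mul_sum]
  refine sum_congr rfl fun k hk => ?_
  obtain ⟨m, rfl⟩ := Nat.exists_eq_add_of_le (Nat.lt_succ_iff.mp (mem_range.mp hk))
  have h1 : (-1 : ℝ) ^ k * (-1) ^ k = 1 := by rw [← mul_pow]; simp
  simp only [Nat.add_sub_cancel_left, zsmul_eq_mul, nsmul_eq_mul]
  push_cast
  rw [pow_add]
  linear_combination (-(-1 : ℝ) ^ m * ((k + m).choose k : ℝ) * f (y + k * h)) * h1

lemma fwdDiff_iterate_inv (n : ℕ) {z : ℝ} (hz : 0 < z) :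
    (fwdDiff 1)^[n] (fun x : ℝ => x⁻¹) z
      = (-1) ^ n * n.factorial / ∏ i ∈ range (n + 1), (z + i) := by
  induction n generalizing z with
  | zero => simp
  | succ n ih =>
    have h2 : ∏ i ∈ range (n + 1), (z + 1 + (i : ℝ))
        = (∏ i ∈ range n, (z + ((i + 1 : ℕ) : ℝ))) * (z + 1 + n) := by
      rw [prod_range_succ]
      congr 1
      refine prod_congr rfl fun i _ => ?_
      push_cast
      ring
    rw [Function.iterate_succ_apply', fwdDiff, ih hz, ih (by positivity), h2,
      prod_range_succ _ (n + 1), prod_range_succ' _ n]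
    have h3 : (∏ i ∈ range n, (z + ((i + 1 : ℕ) : ℝ))) ≠ 0 :=
      (prod_pos fun i _ => by positivity).ne'
    generalize (∏ i ∈ range n, (z + ((i + 1 : ℕ) : ℝ))) = c at h3
    rw [Nat.factorial_succ]
    push_cast
    have h4 : z + 1 + n ≠ 0 := by positivity
    have h5 : z + (n + 1) ≠ 0 := by positivity
    field_simp
    ring

lemma sum_neg_one_pow_mul_choose_mul_inv (n : ℕ) {z : ℝ} (hz : 0 < z) :
    ∑ k ∈ range (n + 1), (-1) ^ k * (n.choose k : ℝ) * (z + k)⁻¹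
      = n.factorial / ∏ i ∈ range (n + 1), (z + i) := by
  have h := fwdDiff_iterate_inv n hz
  rw [fwdDiff_iterate_eq_neg_one_pow_mul, mul_div_assoc] at h
  simpa using mul_left_cancel₀ (pow_ne_zero n (by norm_num)) h

open Polynomial in
lemma sum_neg_one_pow_mul_choose_mul_eval {p : ℝ[X]} {n : ℕ} (hp : p.natDegree < n) (z : ℝ) :
    ∑ k ∈ range (n + 1), (-1) ^ k * (n.choose k : ℝ) * p.eval (z + k) = 0 := by
  have h := congrFun (fwdDiff_iter_eq_zero_of_degree_lt hp) z
  rw [fwdDiff_iterate_eq_neg_one_pow_mul] at h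
  simpa using h

lemma prod_range_sub_self (k : ℕ) :
    ∏ i ∈ range k, ((i : ℝ) - k) = (-1) ^ k * k.factorial := by
  induction k with
  | zero => simp
  | succ k ih =>
    rw [prod_range_succ']
    have : ∏ i ∈ range k, (((i + 1 : ℕ) : ℝ) - (k + 1 : ℕ)) = ∏ i ∈ range k, ((i : ℝ) - k) :=
      prod_congr rfl fun i _ => by push_cast; ring
    rw [this, ih, Nat.factorial_succ]
    push_cast
    ring

lemma prod_range_add_sub (b L : ℕ) :
    ∏ l ∈ range L, ((b : ℝ) + L - l) = L.factorial * (b + L).choose L := by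
  rw [← Nat.cast_mul, ← Nat.descFactorial_eq_factorial_mul_choose, Nat.descFactorial_eq_prod_range,
    Nat.cast_prod]
  refine prod_congr rfl fun l hl => ?_
  rw [Nat.cast_sub (by have := mem_range.mp hl; omega)]
  push_cast
  ring

/-- The polynomial `x(x+1)⋯(x+L) (M-x)(M-x-1)⋯(M-x-L+1)`, whose `L`-th backward difference is `x`
times the extremal polynomial (a Rodrigues formula). -/
noncomputable def rodriguesPoly (L M : ℕ) : Polynomial ℝ :=
  (∏ i ∈ range (L + 1), (Polynomial.X + Polynomial.C (i : ℝ))) *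
    ∏ l ∈ range L, (Polynomial.C ((M : ℝ) - l) - Polynomial.X)

/-- The quotient of `rodriguesPoly L M (x - k)` by `x`, for `k ≤ L`. -/
noncomputable def rodriguesQuot (L M k : ℕ) : Polynomial ℝ :=
  ((∏ i ∈ range k, (Polynomial.X + Polynomial.C ((i : ℝ) - k))) *
    ∏ i ∈ range (L - k), (Polynomial.X + Polynomial.C ((i : ℝ) + 1))) *
    ∏ l ∈ range L, (Polynomial.C ((M : ℝ) + k - l) - Polynomial.X)

/-- The polynomial of degree at most `L` orthogonal to `x, …, x ^ L` on `{1, …, M}`. -/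
noncomputable def extremalPoly (L M : ℕ) : Polynomial ℝ :=
  ∑ k ∈ range (L + 1), Polynomial.C ((-1) ^ k * (L.choose k : ℝ)) * rodriguesQuot L M k

lemma rodriguesPoly_eval (L M : ℕ) (x : ℝ) :
    (rodriguesPoly L M).eval x
      = (∏ i ∈ range (L + 1), (x + i)) * ∏ l ∈ range L, ((M : ℝ) - l - x) := by
  simp [rodriguesPoly, Polynomial.eval_prod]

lemma mul_rodriguesQuot_eval {L M k : ℕ} (hk : k ≤ L) (x : ℝ) :
    x * (rodriguesQuot L M k).eval x = (rodriguesPoly L M).eval (x - k) := by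
  obtain ⟨m, rfl⟩ := Nat.exists_eq_add_of_le hk
  rw [rodriguesPoly_eval, add_right_comm, prod_range_add, prod_range_succ]
  simp only [rodriguesQuot, Polynomial.eval_prod, Polynomial.eval_mul, Polynomial.eval_add,
    Polynomial.eval_sub, Polynomial.eval_X, Polynomial.eval_C, Nat.add_sub_cancel_left]
  have h1 : ∏ i ∈ range k, (x - k + (i : ℝ)) = ∏ i ∈ range k, (x + ((i : ℝ) - k)) :=
    prod_congr rfl fun i _ => by ring
  have h2 : ∏ i ∈ range m, (x - k + ((k + 1 + i : ℕ) : ℝ)) = ∏ i ∈ range m, (x + ((i : ℝ) + 1)) :=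
    prod_congr rfl fun i _ => by push_cast; ring
  have h3 : ∏ l ∈ range (k + m), ((M : ℝ) - l - (x - k))
      = ∏ l ∈ range (k + m), ((M : ℝ) + k - l - x) :=
    prod_congr rfl fun i _ => by ring
  rw [h1, h2, h3]
  ring

lemma mul_extremalPoly_eval (L M : ℕ) (x : ℝ) :
    x * (extremalPoly L M).eval x
      = ∑ k ∈ range (L + 1), (-1) ^ k * (L.choose k : ℝ) * (rodriguesPoly L M).eval (x - k) := by
  rw [extremalPoly, Polynomial.eval_finsetSum, mul_sum]
  refine sum_congr rfl fun k hk => ?_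
  rw [← mul_rodriguesQuot_eval (Nat.lt_succ_iff.mp (mem_range.mp hk)), Polynomial.eval_mul,
    Polynomial.eval_C]
  ring

open Polynomial in
lemma natDegree_rodriguesPoly_le (L M : ℕ) : (rodriguesPoly L M).natDegree ≤ 2 * L + 1 := by
  have h1 : (∏ i ∈ range (L + 1), (X + C (i : ℝ))).natDegree ≤ L + 1 := by
    refine (natDegree_prod_le _ _).trans ?_
    simp only [natDegree_X_add_C, sum_const, card_range, smul_eq_mul, mul_one, le_refl]
  have h2 : (∏ l ∈ range L, (C ((M : ℝ) - l) - X)).natDegree ≤ L := by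
    refine (natDegree_prod_le _ _).trans ?_
    refine (sum_le_card_nsmul _ _ 1 fun l _ => ?_).trans (by simp)
    exact (natDegree_sub_le _ _).trans (by rw [natDegree_C, natDegree_X]; simp)
  exact natDegree_mul_le.trans (by omega)

open Polynomial in
lemma natDegree_extremalPoly_le (L M : ℕ) : (extremalPoly L M).natDegree ≤ L := by
  have h : C ((-1) ^ L) * (X * extremalPoly L M)
      = (fun q : ℝ[X] => taylor (-1) q - q)^[L] (rodriguesPoly L M) := by
    refine Polynomial.funext fun x => ?_
    rw [eval_iterate_taylor_sub, fwdDiff_iterate_eq_neg_one_pow_mul, eval_mul, eval_mul, eval_X,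
      mul_extremalPoly_eval, eval_C]
    simp [sub_eq_add_neg]
  have hd := natDegree_iterate_taylor_sub_le (-1) (rodriguesPoly L M) L
  rw [← h, natDegree_C_mul (by simp)] at hd
  by_cases h0 : extremalPoly L M = 0
  · simp [h0]
  · rw [natDegree_X_mul h0] at hd
    have := natDegree_rodriguesPoly_le L M
    omega

lemma extremalPoly_eval_zero (L N : ℕ) :
    (extremalPoly L (N + L)).eval 0
      = (L.factorial : ℝ) ^ 2 * ∑ k ∈ range (L + 1), ((N + k + L).choose L : ℝ) := by
  rw [extremalPoly, Polynomial.eval_finsetSum, mul_sum]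
  refine sum_congr rfl fun k hk => ?_
  have hkL := Nat.lt_succ_iff.mp (mem_range.mp hk)
  have h1 := prod_range_sub_self k
  have h2 : ∏ i ∈ range (L - k), ((i : ℝ) + 1) = (L - k).factorial := by
    rw [← prod_range_add_one_eq_factorial]
    push_cast
    rfl
  have h3 := prod_range_add_sub (N + k) L
  have h4 : ∏ l ∈ range L, (((N + L : ℕ) : ℝ) + k - l)
      = ∏ l ∈ range L, (((N + k : ℕ) : ℝ) + L - l) :=
    prod_congr rfl fun l _ => by push_cast; ring
  have h5 : (L.choose k : ℝ) * k.factorial * (L - k).factorial = L.factorial := by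
    exact_mod_cast Nat.choose_mul_factorial_mul_factorial hkL
  have h6 : (-1 : ℝ) ^ k * (-1) ^ k = 1 := by rw [← mul_pow]; simp
  simp only [rodriguesQuot, Polynomial.eval_prod, Polynomial.eval_mul, Polynomial.eval_add,
    Polynomial.eval_sub, Polynomial.eval_X, Polynomial.eval_C, zero_add, sub_zero]
  rw [h1, h2, h4, h3]
  linear_combination ((L.choose k : ℝ) * k.factorial * (L - k).factorial * L.factorial *
    (N + k + L).choose L) * h6 + (L.factorial * ((N + k + L).choose L : ℝ)) * h5

/-- Summation by parts against the extremal polynomial. -/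
lemma sum_mul_extremalPoly (L N : ℕ) (h : ℝ → ℝ) :
    ∑ i ∈ range (N + L), h (i + 1) * ((i + 1) * (extremalPoly L (N + L)).eval ((i : ℝ) + 1))
      = ∑ t ∈ range N, (rodriguesPoly L (N + L)).eval ((t : ℝ) + 1) *
          ∑ k ∈ range (L + 1), (-1) ^ k * (L.choose k : ℝ) * h (t + 1 + k) := by
  simp_rw [mul_extremalPoly_eval, mul_sum]
  rw [sum_comm, sum_comm (s := range N)]
  refine sum_congr rfl fun k hk => ?_
  obtain ⟨m, rfl⟩ := Nat.exists_eq_add_of_le (Nat.lt_succ_iff.mp (mem_range.mp hk))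
  rw [show N + (k + m) = k + N + m by ring, sum_range_add, sum_range_add, sum_eq_zero,
    sum_eq_zero (s := range m), zero_add, add_zero]
  · refine sum_congr rfl fun t _ => ?_
    push_cast
    rw [show (k : ℝ) + t + 1 - k = t + 1 by ring, show (k : ℝ) + t + 1 = t + 1 + k by ring]
    ring
  · intro i hi
    have hi := mem_range.mp hi
    rw [rodriguesPoly_eval, prod_eq_zero (s := range (k + m)) (i := k + m - 1 - i)]
    · simp
    · exact mem_range.mpr (by omega)
    · rw [Nat.sub_sub, Nat.cast_sub (by omega)]
      push_cast
      ring
  · intro i hi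
    have hi := mem_range.mp hi
    rw [rodriguesPoly_eval, prod_eq_zero (i := k - 1 - i)]
    · simp
    · exact mem_range.mpr (by omega)
    · rw [Nat.sub_sub, Nat.cast_sub (by omega)]
      push_cast
      ring

lemma sum_pow_mul_extremalPoly {L j : ℕ} (N : ℕ) (hj : j < L) :
    ∑ i ∈ range (N + L), ((i : ℝ) + 1) ^ (j + 1) * (extremalPoly L (N + L)).eval ((i : ℝ) + 1)
      = 0 := by
  have h := sum_mul_extremalPoly L N fun x => x ^ j
  simp only [← mul_assoc, ← pow_succ] at h
  rw [h]
  refine sum_eq_zero fun t _ => ?_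
  have h0 := sum_neg_one_pow_mul_choose_mul_eval (p := Polynomial.X ^ j) (n := L) (by simpa)
    ((t : ℝ) + 1)
  simp only [Polynomial.eval_pow, Polynomial.eval_X] at h0
  rw [h0, mul_zero]

lemma sum_extremalPoly (L N : ℕ) :
    ∑ i ∈ range (N + L), (extremalPoly L (N + L)).eval ((i : ℝ) + 1)
      = (L.factorial : ℝ) ^ 2 * ∑ t ∈ range N, ((t + L).choose L : ℝ) := by
  have h := sum_mul_extremalPoly L N fun x => x⁻¹
  have h1 : ∀ i : ℕ, ((i : ℝ) + 1)⁻¹ * ((i + 1) * (extremalPoly L (N + L)).eval ((i : ℝ) + 1))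
      = (extremalPoly L (N + L)).eval ((i : ℝ) + 1) := fun i =>
    inv_mul_cancel_left₀ (by positivity) _
  simp only [h1] at h
  rw [h, mul_sum, ← sum_range_reflect]
  refine sum_congr rfl fun t ht => ?_
  have ht := mem_range.mp ht
  have hb : ((N - 1 - t : ℕ) : ℝ) + 1 = N - t := by
    rw [Nat.sub_sub, Nat.cast_sub (by omega)]
    push_cast
    ring
  rw [sum_neg_one_pow_mul_choose_mul_inv L (by positivity), rodriguesPoly_eval]
  have h2 : (∏ i ∈ range (L + 1), (((N - 1 - t : ℕ) : ℝ) + 1 + i)) ≠ 0 :=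
    (prod_pos fun i _ => by positivity).ne'
  have h3 : ∏ l ∈ range L, (((N + L : ℕ) : ℝ) - l - (((N - 1 - t : ℕ) : ℝ) + 1))
      = L.factorial * (t + L).choose L := by
    rw [← prod_range_add_sub]
    refine prod_congr rfl fun l _ => ?_
    rw [hb]
    push_cast
    ring
  rw [h3]
  field_simp

lemma sum_range_add_choose_eq (L n : ℕ) :
    ∑ t ∈ range n, ((t + L).choose L : ℝ) = (n + L).choose (L + 1) := by
  induction n with
  | zero => simp
  | succ n ih =>
    rw [sum_range_succ, ih, add_right_comm n 1 L, Nat.choose_succ_succ]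
    push_cast
    ring

open Polynomial in
lemma eval_eq_eval_zero_add_sum {p : ℝ[X]} {L : ℕ} (hp : p.natDegree ≤ L) (x : ℝ) :
    p.eval x = p.eval 0 + ∑ j ∈ range L, p.coeff (j + 1) * x ^ (j + 1) := by
  rw [eval_eq_sum_range' (Nat.lt_succ_of_le hp), sum_range_succ', coeff_zero_eq_eval_zero]
  simp [add_comm]

/-- For integers `L ≥ 1` and `M ≥ L+1`, with `B` the `M × L` matrix with
entries `B_{i,j} = (i/M)^j` (`i = 1,…,M`, `j = 1,…,L`), the minimum over `w ∈ ℝ^L` of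
`‖Bw − 𝟏‖₂` equals `(binom(M+L+1,L+1)/binom(M,L+1) − 1)^{-1/2}`. -/
theorem stmt0 (L M : ℕ) (hL : 1 ≤ L) (hM : L + 1 ≤ M) :
    IsLeast
      {x : ℝ | ∃ w : Fin L → ℝ,
        x = Real.sqrt (∑ i : Fin M,
              ((∑ j : Fin L, ((i.1 + 1 : ℝ) / M) ^ (j.1 + 1) * w j) - 1) ^ 2)}
      ((((M + L + 1).choose (L + 1) : ℝ) / (M.choose (L + 1) : ℝ) - 1) ^ (-(1 / 2) : ℝ)) := by
  obtain ⟨N, rfl⟩ := Nat.exists_eq_add_of_le' (show L ≤ M by omega)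
  have hMpos : (0 : ℝ) < ((N + L : ℕ) : ℝ) := by exact_mod_cast (by omega : 0 < N + L)
  set q := extremalPoly L (N + L) with hq
  set S := ∑ i ∈ range (N + L), q.eval ((i : ℝ) + 1) with hS
  have ha : (0 : ℝ) < (N + L).choose (L + 1) := by exact_mod_cast Nat.choose_pos hM
  have hf : (0 : ℝ) < (L.factorial : ℝ) ^ 2 := by positivity
  have hSa : S = (L.factorial : ℝ) ^ 2 * (N + L).choose (L + 1) := by
    rw [hS, hq, sum_extremalPoly, sum_range_add_choose_eq]
  have hsum : ∑ k ∈ range (L + 1), ((N + k + L).choose L : ℝ)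
      = (N + L + L + 1).choose (L + 1) - (N + L).choose (L + 1) := by
    have h := sum_range_add_choose_eq L (N + (L + 1))
    rw [sum_range_add, sum_range_add_choose_eq, show N + (L + 1) + L = N + L + L + 1 by ring] at h
    linarith
  have hq0 : q.eval 0 = (L.factorial : ℝ) ^ 2 *
      ((N + L + L + 1).choose (L + 1) - (N + L).choose (L + 1)) := by
    rw [hq, extremalPoly_eval_zero, hsum]
  have hb : (0 : ℝ) < (N + L + L + 1).choose (L + 1) - (N + L).choose (L + 1) := by
    rw [← hsum]
    exact sum_pos (fun k _ => by exact_mod_cast Nat.choose_pos (by omega)) (by simp)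
  have hq0pos : 0 < q.eval 0 := by rw [hq0]; positivity
  have hSpos : 0 < S := by rw [hSa]; positivity
  have hval : (((N + L + L + 1).choose (L + 1) : ℝ) / ((N + L).choose (L + 1) : ℝ) - 1)
      ^ (-(1 / 2) : ℝ) = Real.sqrt (S / q.eval 0) := by
    rw [hSa, hq0, mul_div_mul_left _ _ hf.ne', Real.sqrt_eq_rpow, div_sub_one ha.ne',
      Real.rpow_neg (by positivity), ← Real.inv_rpow (by positivity), inv_div]
  have horth : ∀ c : ℕ → ℝ, ∑ i ∈ range (N + L),
      (∑ j ∈ range L, c j * ((i : ℝ) + 1) ^ (j + 1)) * q.eval ((i : ℝ) + 1) = 0 := by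
    intro c
    simp_rw [sum_mul]
    rw [sum_comm]
    refine sum_eq_zero fun j hj => ?_
    simp_rw [mul_assoc]
    rw [← mul_sum, sum_pow_mul_extremalPoly N (mem_range.mp hj), mul_zero]
  have hqeval := fun x => eval_eq_eval_zero_add_sum (natDegree_extremalPoly_le L (N + L)) x
  rw [← hq] at hqeval
  have hsq : ∑ i ∈ range (N + L), q.eval ((i : ℝ) + 1) ^ 2 = q.eval 0 * S := by
    have h := horth fun j => q.coeff (j + 1)
    rw [hS, mul_sum, ← sub_eq_zero, ← sum_sub_distrib]
    refine (sum_congr rfl fun i _ => ?_).trans h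
    linear_combination q.eval ((i : ℝ) + 1) * hqeval ((i : ℝ) + 1)
  rw [hval]
  constructor
  · refine ⟨fun j => -q.coeff (j.1 + 1) * ((N + L : ℕ) : ℝ) ^ (j.1 + 1) / q.eval 0, ?_⟩
    congr 1
    rw [Fin.sum_univ_eq_sum_range fun i : ℕ => ((∑ j : Fin L,
      (((i : ℝ) + 1) / ((N + L : ℕ) : ℝ)) ^ (j.1 + 1) *
        (-q.coeff (j.1 + 1) * ((N + L : ℕ) : ℝ) ^ (j.1 + 1) / q.eval 0)) - 1) ^ 2]
    have hterm : ∀ i : ℕ, ((∑ j : Fin L, (((i : ℝ) + 1) / ((N + L : ℕ) : ℝ)) ^ (j.1 + 1) *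
        (-q.coeff (j.1 + 1) * ((N + L : ℕ) : ℝ) ^ (j.1 + 1) / q.eval 0)) - 1) ^ 2
        = q.eval ((i : ℝ) + 1) ^ 2 / q.eval 0 ^ 2 := by
      intro i
      rw [Fin.sum_univ_eq_sum_range fun j : ℕ => (((i : ℝ) + 1) / ((N + L : ℕ) : ℝ)) ^ (j + 1) *
        (-q.coeff (j + 1) * ((N + L : ℕ) : ℝ) ^ (j + 1) / q.eval 0)]
      have h1 : ∑ j ∈ range L, (((i : ℝ) + 1) / ((N + L : ℕ) : ℝ)) ^ (j + 1) *
          (-q.coeff (j + 1) * ((N + L : ℕ) : ℝ) ^ (j + 1) / q.eval 0)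
          = -(∑ j ∈ range L, q.coeff (j + 1) * ((i : ℝ) + 1) ^ (j + 1)) / q.eval 0 := by
        rw [← sum_neg_distrib, sum_div]
        refine sum_congr rfl fun j _ => ?_
        rw [div_pow]
        field_simp
      rw [h1, ← div_pow, hqeval ((i : ℝ) + 1)]
      field_simp
      ring
    simp_rw [hterm]
    rw [← sum_div, hsq]
    field_simp
  · rintro _ ⟨w, rfl⟩
    refine Real.sqrt_le_sqrt ?_
    obtain ⟨c, hc⟩ : ∃ c : ℕ → ℝ, ∀ j : Fin L, w j = c j :=
      ⟨fun j => if h : j < L then w ⟨j, h⟩ else 0, fun j => by simp⟩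
    simp_rw [hc]
    set p : ℕ → ℝ := fun i => (∑ j ∈ range L,
      (c j / ((N + L : ℕ) : ℝ) ^ (j + 1)) * ((i : ℝ) + 1) ^ (j + 1)) - 1 with hp
    have hpw : ∀ i : ℕ, (∑ j : Fin L, (((i : ℝ) + 1) / ((N + L : ℕ) : ℝ)) ^ (j.1 + 1) * c j) - 1
        = p i := by
      intro i
      rw [Fin.sum_univ_eq_sum_range fun j : ℕ =>
        (((i : ℝ) + 1) / ((N + L : ℕ) : ℝ)) ^ (j + 1) * c j, hp]
      congr 1
      refine sum_congr rfl fun j _ => ?_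
      rw [div_pow]
      ring
    simp_rw [hpw]
    rw [Fin.sum_univ_eq_sum_range fun i : ℕ => p i ^ 2]
    have hinner : ∑ i ∈ range (N + L), p i * q.eval ((i : ℝ) + 1) = -S := by
      simp only [hp, sub_mul, one_mul]
      rw [sum_sub_distrib, horth fun j => c j / ((N + L : ℕ) : ℝ) ^ (j + 1), zero_sub]
    have hcs := sum_mul_sq_le_sq_mul_sq (range (N + L)) p fun i => q.eval ((i : ℝ) + 1)
    rw [hinner, hsq] at hcs
    rw [div_le_iff₀ hq0pos]
    refine le_of_mul_le_mul_right ?_ hSpos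
    linarith
end

section
/- There exists an absolute constant c > 0 such that for all integers k ≥ 1, 1 ≤ Δ < k/4, and n, if n ≤ c·k·arccosh(1 + k/(4Δ²)), then for every estimator Ĉ : (Fin k)^n → ℤ there exists a coloring f : Fin k → Fin k such that, letting C(f) be the number of distinct values of f and X_1,…,X_n be i.i.d. uniform on Fin k, one has P( |Ĉ(f(X_1),…,f(X_n)) − C(f)| ≥ Δ ) > 0.1. -/
open Finset MeasureTheory ProbabilityTheory
open scoped ENNReal NNReal

/-- The involution exchanging the two members of each pair. -/
def flipSnd {β : Type*} (a : β × Bool) : β × Bool := (a.1, !a.2)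

theorem flipSnd_ne {β : Type*} (a : β × Bool) : flipSnd a ≠ a := by
  intro h
  have := congrArg Prod.snd h
  simp [flipSnd] at this

theorem flipSnd_flipSnd {β : Type*} (a : β × Bool) : flipSnd (flipSnd a) = a := by
  simp [flipSnd]

theorem flipSnd_injective {β : Type*} : Function.Injective (flipSnd (β := β)) :=
  Function.LeftInverse.injective flipSnd_flipSnd

/-- The coloring giving `e (i, flipSnd (θ i))` the color of `e (i, θ i)` for every `i`, and every
other element its own color. -/
noncomputable def mergeColoring {ι β α : Type*} (e : ι × β × Bool ↪ α) (θ : ι → β × Bool) : α → α :=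
  Function.extend (fun i => e (i, flipSnd (θ i))) (fun i => e (i, θ i)) id

section

variable {ι β α : Type*} (e : ι × β × Bool ↪ α) (θ : ι → β × Bool)

theorem injective_dead : Function.Injective (fun i => e (i, flipSnd (θ i))) := by
  intro i j h
  exact congrArg Prod.fst (e.injective h)

theorem mergeColoring_dead (i : ι) : mergeColoring e θ (e (i, flipSnd (θ i))) = e (i, θ i) :=
  (injective_dead e θ).extend_apply _ _ i

theorem mergeColoring_of_forall_ne {x : α} (h : ∀ i, e (i, flipSnd (θ i)) ≠ x) :
    mergeColoring e θ x = x :=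
  Function.extend_apply' _ _ _ (by rintro ⟨i, hi⟩; exact h i hi)

theorem card_image_mergeColoring [Fintype ι] [Fintype α] [DecidableEq α] :
    (univ.image (mergeColoring e θ)).card + Fintype.card ι = Fintype.card α := by
  have h : univ.image (mergeColoring e θ) = (univ.image fun i => e (i, flipSnd (θ i)))ᶜ := by
    ext y
    simp only [mem_image, mem_univ, true_and, mem_compl, not_exists]
    constructor
    · rintro ⟨x, rfl⟩ j hj
      by_cases hx : ∃ i, e (i, flipSnd (θ i)) = x
      · obtain ⟨i, rfl⟩ := hx
        rw [mergeColoring_dead] at hj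
        have hji := e.injective hj
        obtain rfl : j = i := congrArg Prod.fst hji
        exact flipSnd_ne _ (congrArg Prod.snd hji)
      · push Not at hx
        rw [mergeColoring_of_forall_ne e θ hx] at hj
        exact hx j hj
    · intro h
      exact ⟨y, mergeColoring_of_forall_ne e θ h⟩
  rw [h, ← card_compl_add_card (univ.image fun i => e (i, flipSnd (θ i))),
    card_image_of_injective _ (injective_dead e θ), card_univ]

/-- The number of elements of color `y`. -/
noncomputable def colorCount {α : Type*} [Fintype α] [DecidableEq α] (f : α → α) (y : α) : ℝ :=
  ∑ x, if f x = y then 1 else 0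

theorem colorCount_nonneg {α : Type*} [Fintype α] [DecidableEq α] (f : α → α) (y : α) :
    0 ≤ colorCount f y :=
  sum_nonneg fun _ _ => by split_ifs <;> norm_num

theorem sum_colorCount {α : Type*} [Fintype α] [DecidableEq α] (f : α → α) :
    ∑ y, colorCount f y = Fintype.card α := by
  simp only [colorCount]
  rw [sum_comm]
  simp

theorem card_filter_comp {α : Type*} [Fintype α] [DecidableEq α] (f : α → α) {n : ℕ}
    (A : Finset (Fin n → α)) :
    ((univ.filter fun x : Fin n → α => (fun t => f (x t)) ∈ A).card : ℝ) =
      ∑ y ∈ A, ∏ t, colorCount f (y t) := by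
  have h (y : Fin n → α) : ∏ t, colorCount f (y t) =
      ∑ x : Fin n → α, if (fun t => f (x t)) = y then (1 : ℝ) else 0 := by
    simp only [colorCount]
    rw [prod_univ_sum, Fintype.piFinset_univ]
    refine sum_congr rfl fun x _ => ?_
    rw [prod_ite_zero]
    simp [funext_iff]
  simp only [h]
  rw [sum_comm]
  simp

theorem colorCount_mergeColoring [Fintype ι] [Fintype α] [DecidableEq α] (y : α) :
    colorCount (mergeColoring e θ) y =
      1 + ∑ i, ((if e (i, θ i) = y then 1 else 0) -
        (if e (i, flipSnd (θ i)) = y then 1 else 0)) := by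
  classical
  have h (x : α) : (if mergeColoring e θ x = y then (1 : ℝ) else 0) = (if x = y then 1 else 0) +
      ∑ i, if e (i, flipSnd (θ i)) = x then ((if e (i, θ i) = y then 1 else 0) -
        (if e (i, flipSnd (θ i)) = y then 1 else 0)) else 0 := by
    by_cases hx : ∃ i, e (i, flipSnd (θ i)) = x
    · obtain ⟨i, rfl⟩ := hx
      rw [mergeColoring_dead, sum_eq_single i]
      · simp
      · intro j _ hj
        rw [if_neg fun h => hj (injective_dead e θ h)]
      · simp
    · push Not at hx
      rw [mergeColoring_of_forall_ne e θ hx, sum_eq_zero, add_zero]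
      exact fun i _ => if_neg (hx i)
  simp only [colorCount, h]
  rw [sum_add_distrib, sum_comm]
  simp

/-- The excess correlation of the color counts of two merged pairs. -/
def pairCorr {β : Type*} [DecidableEq β] (a b : β × Bool) : ℝ :=
  (if b = a then 2 else 0) - (if b = flipSnd a then 2 else 0)

theorem sum_colorCount_mul [Fintype ι] [Fintype α] [DecidableEq α] [DecidableEq β]
    (θ' : ι → β × Bool) :
    ∑ y, colorCount (mergeColoring e θ) y * colorCount (mergeColoring e θ') y =
      Fintype.card α + ∑ i, pairCorr (θ i) (θ' i) := by
  classical
  have hs (i j : ι) (a b : β × Bool) : (∑ y : α, (if e (i, a) = y then (1 : ℝ) else 0) *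
      (if e (j, b) = y then 1 else 0)) = if j = i then (if b = a then 1 else 0) else 0 := by
    simp only [ite_mul, one_mul, zero_mul, sum_ite_eq, mem_univ, if_true, e.injective.eq_iff,
      Prod.mk.injEq, ite_and]
  simp only [colorCount_mergeColoring, add_mul, mul_add, one_mul, mul_one, sum_add_distrib]
  have h1 (φ : ι → β × Bool) : ∑ y : α, ∑ i, ((if e (i, φ i) = y then (1 : ℝ) else 0) -
        (if e (i, flipSnd (φ i)) = y then 1 else 0)) = 0 := by
    rw [sum_comm]
    simp [sum_sub_distrib]
  rw [h1, h1]
  have h2 : ∑ y : α, (∑ i, ((if e (i, θ i) = y then (1 : ℝ) else 0) -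
        (if e (i, flipSnd (θ i)) = y then 1 else 0))) *
      (∑ i, ((if e (i, θ' i) = y then (1 : ℝ) else 0) -
        (if e (i, flipSnd (θ' i)) = y then 1 else 0))) = ∑ i, pairCorr (θ i) (θ' i) := by
    simp only [sum_mul_sum]
    rw [sum_comm]
    refine sum_congr rfl fun i _ => ?_
    rw [sum_comm]
    simp only [sub_mul, mul_sub, sum_sub_distrib, hs]
    simp only [sum_ite_eq', mem_univ, if_true, pairCorr, flipSnd_injective.eq_iff]
    have h3 : flipSnd (θ' i) = θ i ↔ θ' i = flipSnd (θ i) :=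
      ⟨fun h => by rw [← h, flipSnd_flipSnd], fun h => by rw [h, flipSnd_flipSnd]⟩
    simp only [h3]
    split_ifs <;> norm_num
  rw [h2]
  simp

theorem sum_exp_pairCorr {β : Type*} [Fintype β] [DecidableEq β] (a : β × Bool) (l : ℝ) :
    ∑ b, Real.exp (l * pairCorr a b) =
      2 * Fintype.card β + 2 * (Real.cosh (2 * l) - 1) := by
  have h (b : β × Bool) : Real.exp (l * pairCorr a b) = 1 +
      ((if b = a then Real.exp (2 * l) - 1 else 0) +
        (if b = flipSnd a then Real.exp (-(2 * l)) - 1 else 0)) := by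
    have hne := flipSnd_ne a
    unfold pairCorr
    by_cases h1 : b = a
    · subst h1
      simp [hne.symm, mul_comm]
    · by_cases h2 : b = flipSnd a
      · subst h2
        simp [hne, mul_comm]
      · simp [h1, h2]
  simp only [h, sum_add_distrib]
  simp [Real.cosh_eq]
  ring

/-- Second-moment bound for the mixture, over `θ`, of the laws of the observed colors. -/
theorem sum_sq_mixture_le [Fintype ι] [Fintype β] [Fintype α] [DecidableEq α] [DecidableEq ι]
    [Nonempty α] (n : ℕ) :
    ∑ y : Fin n → α, (∑ θ : ι → β × Bool, ∏ t, colorCount (mergeColoring e θ) (y t)) ^ 2 ≤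
      (2 * Fintype.card β : ℝ) ^ Fintype.card ι * (Fintype.card α : ℝ) ^ n *
        (2 * Fintype.card β + 2 * (Real.cosh (2 * (n / Fintype.card α)) - 1)) ^
          Fintype.card ι := by
  classical
  set k : ℝ := (Fintype.card α : ℝ) with hk
  have hk0 : 0 < k := by rw [hk]; exact_mod_cast Fintype.card_pos
  have hb (θ θ' : ι → β × Bool) :
      ∑ y : Fin n → α, (∏ t, colorCount (mergeColoring e θ) (y t)) *
        (∏ t, colorCount (mergeColoring e θ') (y t)) ≤
      k ^ n * ∏ i, Real.exp (n / k * pairCorr (θ i) (θ' i)) := by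
    have h0 : ∑ y : Fin n → α, (∏ t, colorCount (mergeColoring e θ) (y t)) *
        (∏ t, colorCount (mergeColoring e θ') (y t)) =
        (∑ y, colorCount (mergeColoring e θ) y * colorCount (mergeColoring e θ') y) ^ n := by
      have := prod_univ_sum (fun _ : Fin n => (univ : Finset α))
        (fun _ y => colorCount (mergeColoring e θ) y * colorCount (mergeColoring e θ') y)
      rw [Fintype.piFinset_univ] at this
      simp only [prod_const, card_univ, Fintype.card_fin, prod_mul_distrib] at this
      exact this.symm
    have hnn : 0 ≤ ∑ y, colorCount (mergeColoring e θ) y * colorCount (mergeColoring e θ') y :=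
      sum_nonneg fun y _ => mul_nonneg (colorCount_nonneg _ _) (colorCount_nonneg _ _)
    rw [sum_colorCount_mul, ← hk] at h0 hnn
    rw [h0]
    have hle : k + ∑ i, pairCorr (θ i) (θ' i) ≤
        k * Real.exp ((∑ i, pairCorr (θ i) (θ' i)) / k) := by
      have := Real.add_one_le_exp ((∑ i, pairCorr (θ i) (θ' i)) / k)
      calc k + ∑ i, pairCorr (θ i) (θ' i) = k * ((∑ i, pairCorr (θ i) (θ' i)) / k + 1) := by
            field_simp
            ring
        _ ≤ _ := by gcongr
    calc (k + ∑ i, pairCorr (θ i) (θ' i)) ^ n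
        ≤ (k * Real.exp ((∑ i, pairCorr (θ i) (θ' i)) / k)) ^ n := pow_le_pow_left₀ hnn hle n
      _ = _ := by
        rw [mul_pow, ← Real.exp_nat_mul, ← Real.exp_sum, ← mul_sum]
        congr 2
        ring
  calc ∑ y : Fin n → α, (∑ θ : ι → β × Bool, ∏ t, colorCount (mergeColoring e θ) (y t)) ^ 2
      = ∑ θ : ι → β × Bool, ∑ θ' : ι → β × Bool, ∑ y : Fin n → α,
          (∏ t, colorCount (mergeColoring e θ) (y t)) *
            (∏ t, colorCount (mergeColoring e θ') (y t)) := by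
        simp only [sq, sum_mul_sum]
        rw [sum_comm]
        refine sum_congr rfl fun θ _ => ?_
        rw [sum_comm]
    _ ≤ ∑ θ : ι → β × Bool, ∑ θ' : ι → β × Bool,
          k ^ n * ∏ i, Real.exp (n / k * pairCorr (θ i) (θ' i)) :=
        sum_le_sum fun θ _ => sum_le_sum fun θ' _ => hb θ θ'
    _ = ∑ θ : ι → β × Bool, k ^ n *
          (2 * Fintype.card β + 2 * (Real.cosh (2 * (n / k)) - 1)) ^ Fintype.card ι := by
        refine sum_congr rfl fun θ _ => ?_
        rw [← mul_sum]
        congr 1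
        have := prod_univ_sum (fun _ : ι => (univ : Finset (β × Bool)))
          (fun i b => Real.exp (n / k * pairCorr (θ i) b))
        rw [Fintype.piFinset_univ] at this
        rw [← this]
        simp only [sum_exp_pairCorr, prod_const, card_univ]
    _ = _ := by
        rw [sum_const, card_univ, nsmul_eq_mul]
        simp only [Fintype.card_fun, Fintype.card_prod, Fintype.card_bool]
        push_cast
        ring

end

theorem pi_uniformOn_apply {k n : ℕ} (S : Set (Fin n → Fin k)) [DecidablePred (· ∈ S)] :
    Measure.pi (fun _ : Fin n => uniformOn (Set.univ : Set (Fin k))) S =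
      ((univ.filter (· ∈ S)).card : ℝ≥0∞) * ((k : ℝ≥0∞)⁻¹) ^ n := by
  have h : S = ((univ.filter (· ∈ S) : Finset (Fin n → Fin k)) : Set (Fin n → Fin k)) := by
    ext; simp
  conv_lhs => rw [h]
  rw [← sum_measure_singleton]
  simp only [Measure.pi_singleton, uniformOn_univ]
  simp

theorem card_le_of_pi_uniformOn_le {k n : ℕ} (hk : 0 < k) (S : Set (Fin n → Fin k))
    [DecidablePred (· ∈ S)]
    (h : Measure.pi (fun _ : Fin n => uniformOn (Set.univ : Set (Fin k))) S ≤ 1 / 10) :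
    ((univ.filter (· ∈ S)).card : ℝ) ≤ (k : ℝ) ^ n / 10 := by
  rw [pi_uniformOn_apply] at h
  have h2 := ENNReal.toReal_mono (by simp) h
  simp only [ENNReal.toReal_mul, ENNReal.toReal_natCast, ENNReal.toReal_pow, ENNReal.toReal_inv,
    ENNReal.toReal_div, ENNReal.toReal_one, ENNReal.toReal_ofNat] at h2
  have hk' : (0 : ℝ) < (k : ℝ) ^ n := by positivity
  rw [inv_pow, ← div_eq_mul_inv, div_le_div_iff₀ hk' (by norm_num)] at h2
  linarith

theorem cosh_mul_sub_one_le {t : ℝ} (ht0 : 0 ≤ t) (ht1 : t ≤ 1) (x : ℝ) :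
    Real.cosh (t * x) - 1 ≤ t * (Real.cosh x - 1) := by
  have hc : ConvexOn ℝ Set.univ Real.exp := convexOn_exp
  have h1 := hc.2 (Set.mem_univ x) (Set.mem_univ 0) ht0 (sub_nonneg.2 ht1) (by ring)
  have h2 := hc.2 (Set.mem_univ (-x)) (Set.mem_univ 0) ht0 (sub_nonneg.2 ht1) (by ring)
  simp only [smul_eq_mul, mul_zero, add_zero, Real.exp_zero, mul_one, mul_neg] at h1 h2
  rw [Real.cosh_eq, Real.cosh_eq]
  linarith

/-- Le Cam's bound: if a test tells the identity coloring from every merged coloring with error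
probabilities at most `1 / 10`, then the mixture over `θ` has a large second moment. -/
theorem card_sq_le_of_errors_le {ι β α : Type*} [Fintype ι] [Fintype β] [Fintype α]
    [DecidableEq α] [DecidableEq ι] (e : ι × β × Bool ↪ α) {n : ℕ} (A : Finset (Fin n → α))
    (hA : ((Aᶜ).card : ℝ) ≤ (Fintype.card α : ℝ) ^ n / 10)
    (h : ∀ θ : ι → β × Bool, ∑ y ∈ A, ∏ t, colorCount (mergeColoring e θ) (y t) ≤
      (Fintype.card α : ℝ) ^ n / 10) :
    81 / 10 * (Fintype.card α : ℝ) ^ n * ((2 * Fintype.card β : ℝ) ^ Fintype.card ι) ^ 2 ≤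
      ∑ y : Fin n → α,
        (∑ θ : ι → β × Bool, ∏ t, colorCount (mergeColoring e θ) (y t)) ^ 2 := by
  set L : (Fin n → α) → ℝ := fun y =>
    ∑ θ : ι → β × Bool, ∏ t, colorCount (mergeColoring e θ) (y t) with hL
  set K : ℝ := (Fintype.card α : ℝ) ^ n with hK
  set N : ℝ := (2 * Fintype.card β : ℝ) ^ Fintype.card ι with hN
  have hN0 : 0 ≤ N := by positivity
  have hK0 : 0 ≤ K := by positivity
  have hcard : ((univ : Finset (ι → β × Bool)).card : ℝ) = N := by
    simp [hN, mul_comm]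
  have htot : ∑ y, L y = N * K := by
    rw [hL, sum_comm, ← hcard, ← nsmul_eq_mul, ← sum_const]
    refine sum_congr rfl fun θ _ => ?_
    have := prod_univ_sum (fun _ : Fin n => (univ : Finset α))
      (fun _ y => colorCount (mergeColoring e θ) y)
    rw [Fintype.piFinset_univ] at this
    rw [← this]
    simp [sum_colorCount, hK]
  have hAL : ∑ y ∈ A, L y ≤ N * (K / 10) := by
    rw [hL, sum_comm, ← hcard, ← nsmul_eq_mul]
    exact sum_le_card_nsmul _ _ _ fun θ _ => h θ
  have hsplit := sum_add_sum_compl A L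
  have hbig : 9 / 10 * (N * K) ≤ ∑ y ∈ Aᶜ, L y := by linarith
  have hcs : (∑ y ∈ Aᶜ, L y) ^ 2 ≤ (Aᶜ).card * ∑ y ∈ Aᶜ, L y ^ 2 := sq_sum_le_card_mul_sum_sq
  have hsub : ∑ y ∈ Aᶜ, L y ^ 2 ≤ ∑ y, L y ^ 2 :=
    sum_le_sum_of_subset_of_nonneg (subset_univ _) fun _ _ _ => sq_nonneg _
  have hQ : 0 ≤ ∑ y, L y ^ 2 := sum_nonneg fun _ _ => sq_nonneg _
  have hmain : (9 / 10 * (N * K)) ^ 2 ≤ K / 10 * ∑ y, L y ^ 2 :=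
    calc (9 / 10 * (N * K)) ^ 2 ≤ (∑ y ∈ Aᶜ, L y) ^ 2 := by gcongr
      _ ≤ _ := hcs
      _ ≤ _ := by gcongr
  rcases hK0.eq_or_lt with h0 | hpos
  · simpa [← h0] using hQ
  · refine le_of_mul_le_mul_left ?_ (show 0 < K / 10 by positivity)
    linarith

/-- There is an absolute constant `c > 0` such that for all integers `k ≥ 1`,
`1 ≤ Δ < k/4`, and `n` with `n ≤ c·k·arccosh(1 + k/(4Δ²))` (where
`arccosh(y) = log(y + √(y² − 1))`): for every estimator `Ĉ : (Fin k)^n → ℤ` there is a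
coloring `f : Fin k → Fin k` such that, with `C(f)` the number of distinct values of `f` and
`X_1,…,X_n` i.i.d. uniform on `Fin k`,
`P(|Ĉ(f(X_1),…,f(X_n)) − C(f)| ≥ Δ) > 0.1`. -/
theorem stmt13 : ∃ c : ℝ, 0 < c ∧
    ∀ k Δ n : ℕ, 1 ≤ k → 1 ≤ Δ → 4 * Δ < k →
      (n : ℝ) ≤ c * k * Real.log ((1 + (k : ℝ) / (4 * (Δ : ℝ) ^ 2)) +
          Real.sqrt ((1 + (k : ℝ) / (4 * (Δ : ℝ) ^ 2)) ^ 2 - 1)) →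
      ∀ Chat : (Fin n → Fin k) → ℤ,
        ∃ f : Fin k → Fin k,
          (1 / 10 : ℝ≥0∞) <
            Measure.pi (fun _ : Fin n => uniformOn (Set.univ : Set (Fin k)))
              {x : Fin n → Fin k |
                (Δ : ℤ) ≤ |Chat (fun t => f (x t)) - ((Finset.univ.image f).card : ℤ)|} := by
  classical
  refine ⟨1 / 8, by norm_num, fun k Δ n hk hΔ hΔk hn Chat => ?_⟩
  by_contra! hcon
  have hk0 : 0 < k := hk
  have : NeZero k := ⟨hk0.ne'⟩
  set b : ℕ := k / (4 * Δ) with hb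
  have hb1 : 1 ≤ b := (Nat.one_le_div_iff (by lia)).2 hΔk.le
  have hbk : b * (4 * Δ) ≤ k := Nat.div_mul_le_self _ _
  have hkb : k < 2 * b * (4 * Δ) := by
    have h1 := Nat.lt_mul_div_succ k (show 0 < 4 * Δ by lia)
    rw [← hb] at h1
    nlinarith
  obtain ⟨e⟩ : Nonempty (Fin (2 * Δ) × Fin b × Bool ↪ Fin k) := by
    apply Function.Embedding.nonempty_of_card_le
    simp only [Fintype.card_prod, Fintype.card_fin, Fintype.card_bool]
    nlinarith
  set A : Finset (Fin n → Fin k) := univ.filter fun y => |Chat y - k| < Δ with hA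
  have hAc : ((Aᶜ).card : ℝ) ≤ (Fintype.card (Fin k) : ℝ) ^ n / 10 := by
    have h := card_le_of_pi_uniformOn_le hk0 _ (hcon id)
    simpa [hA, compl_filter] using h
  have hAθ (θ : Fin (2 * Δ) → Fin b × Bool) :
      ∑ y ∈ A, ∏ t, colorCount (mergeColoring e θ) (y t) ≤
        (Fintype.card (Fin k) : ℝ) ^ n / 10 := by
    have h := card_le_of_pi_uniformOn_le hk0 _ (hcon (mergeColoring e θ))
    rw [← card_filter_comp, Fintype.card_fin]
    refine le_trans ?_ h
    norm_cast
    refine card_le_card fun x hx => ?_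
    have hc := card_image_mergeColoring e θ
    simp only [Fintype.card_fin] at hc
    simp only [hA, mem_filter, mem_univ, true_and, Set.mem_ofPred_eq] at hx ⊢
    have hc' : ((univ.image (mergeColoring e θ)).card : ℤ) = k - 2 * Δ := by
      lia
    rw [hc']
    exact le_abs.2 (Or.inl (by linarith [(abs_lt.1 hx).1]))
  have hlow := card_sq_le_of_errors_le e A hAc hAθ
  have hup := sum_sq_mixture_le (ι := Fin (2 * Δ)) e n
  have hkey := hlow.trans hup
  simp only [Fintype.card_fin] at hkey
  have hkR : (0 : ℝ) < k := by exact_mod_cast hk0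
  have hΔR : (0 : ℝ) < Δ := by exact_mod_cast hΔ
  have hbR : (0 : ℝ) < b := by exact_mod_cast hb1
  set y : ℝ := 1 + (k : ℝ) / (4 * (Δ : ℝ) ^ 2) with hy
  have hy1 : 1 ≤ y := by
    have : 0 ≤ (k : ℝ) / (4 * (Δ : ℝ) ^ 2) := by positivity
    linarith
  have hcosh : Real.cosh (2 * (n / k)) - 1 ≤ 1 / 4 * ((k : ℝ) / (4 * (Δ : ℝ) ^ 2)) := by
    have h1 : 2 * ((n : ℝ) / k) ≤ 1 / 4 * Real.arcosh y := by
      rw [Real.arcosh]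
      have : (n : ℝ) / k ≤ 1 / 8 * Real.log (y + Real.sqrt (y ^ 2 - 1)) := by
        rw [div_le_iff₀ hkR]
        linarith
      linarith
    have h0 : 0 ≤ 2 * ((n : ℝ) / k) := by positivity
    have h2 : Real.cosh (2 * (n / k)) ≤ Real.cosh (1 / 4 * Real.arcosh y) := by
      rw [Real.cosh_le_cosh, abs_of_nonneg h0, abs_of_nonneg (h0.trans h1)]
      exact h1
    have h3 := cosh_mul_sub_one_le (t := 1 / 4) (by norm_num) (by norm_num) (Real.arcosh y)
    rw [Real.cosh_arcosh hy1] at h3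
    have : y - 1 = (k : ℝ) / (4 * (Δ : ℝ) ^ 2) := by rw [hy]; ring
    rw [← this]
    linarith
  have hratio : 2 * (b : ℝ) + 2 * (Real.cosh (2 * (n / k)) - 1) ≤
      2 * b * Real.exp (1 / (2 * Δ)) := by
    have hkb' : (k : ℝ) ≤ 8 * Δ * b := by
      have : k ≤ 8 * Δ * b := by nlinarith
      exact_mod_cast this
    have h1 : Real.cosh (2 * (n / k)) - 1 ≤ b * (1 / (2 * Δ)) := by
      refine hcosh.trans ?_
      rw [← sub_nonneg]
      have : (b : ℝ) * (1 / (2 * Δ)) - 1 / 4 * ((k : ℝ) / (4 * (Δ : ℝ) ^ 2)) =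
          (8 * Δ * b - k) / (16 * Δ ^ 2) := by
        field_simp
        ring
      rw [this]
      exact div_nonneg (sub_nonneg.2 hkb') (by positivity)
    have h2 := Real.add_one_le_exp (1 / (2 * (Δ : ℝ)))
    nlinarith
  have hpow : (2 * (b : ℝ) + 2 * (Real.cosh (2 * (n / k)) - 1)) ^ (2 * Δ) ≤
      (2 * (b : ℝ)) ^ (2 * Δ) * Real.exp 1 := by
    have h0 : 0 ≤ 2 * (b : ℝ) + 2 * (Real.cosh (2 * (n / k)) - 1) := by
      have := Real.one_le_cosh (2 * ((n : ℝ) / k))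
      linarith
    refine (pow_le_pow_left₀ h0 hratio _).trans_eq ?_
    rw [mul_pow, ← Real.exp_nat_mul]
    congr 2
    push_cast
    field_simp
  set N : ℝ := (2 * (b : ℝ)) ^ (2 * Δ) with hN
  have hN0 : 0 < N := by positivity
  have hK0 : 0 < (k : ℝ) ^ n := by positivity
  have hfin : 81 / 10 * ((k : ℝ) ^ n * N ^ 2) ≤ Real.exp 1 * ((k : ℝ) ^ n * N ^ 2) := by
    have : N * (k : ℝ) ^ n * (2 * (b : ℝ) + 2 * (Real.cosh (2 * (n / k)) - 1)) ^ (2 * Δ) ≤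
        N * (k : ℝ) ^ n * (N * Real.exp 1) := by gcongr
    nlinarith
  have := le_of_mul_le_mul_right hfin (by positivity)
  linarith [Real.exp_one_lt_d9]
end
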